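/- arXiv:1903.01417 — 2 statements merged into one kernel-verified Lean document; each statement's English description precedes it below -/
import Mathlib

section
/- Let γ : [0,1] → ℝ² be a path from a to b that passes through a point c ∉ Box(a,b) (i.e., γ(t) = c for some t ∈ [0,1]). Then the L1 length of γ is at least ‖a − c‖₁ + ‖c − b‖₁, and in particular is strictly greater than ‖a − b‖₁. -/
open scoped ENNReal

/-- The plane with the `L1` norm. -/
abbrev Plane := WithLp 1 (ℝ × ℝ)

/-- First coordinate of a point of the plane. -/
noncomputable def xCoord (c : Plane) : ℝ := (WithLp.equiv 1 (ℝ × ℝ) c).1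

/-- Second coordinate of a point of the plane. -/
noncomputable def yCoord (c : Plane) : ℝ := (WithLp.equiv 1 (ℝ × ℝ) c).2

/-- The closed axis-parallel rectangle with `a` and `b` as opposite corners. -/
def Box (a b : Plane) : Set Plane :=
  {c | xCoord c ∈ Set.uIcc (xCoord a) (xCoord b) ∧
       yCoord c ∈ Set.uIcc (yCoord a) (yCoord b)}

/-- The `L1` distance is the sum of the distances of the coordinates. -/
theorem norm_sub_eq_abs_add_abs (p q : Plane) :
    ‖p - q‖ = |xCoord p - xCoord q| + |yCoord p - yCoord q| :=
  WithLp.prod_norm_eq_of_L1 (p - q)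

/-- On the line, the triangle inequality is strict at a point outside the interval. -/
theorem abs_sub_lt_of_notMem_uIcc {p q r : ℝ} (h : r ∉ Set.uIcc p q) :
    |p - q| < |p - r| + |r - q| := by
  rw [Set.mem_uIcc] at h
  grind

/-- The `L1` triangle inequality is strict at a point outside the box. -/
theorem norm_sub_lt_of_notMem_box {a b c : Plane} (h : c ∉ Box a b) :
    ‖a - b‖ < ‖a - c‖ + ‖c - b‖ := by
  simp only [norm_sub_eq_abs_add_abs]
  have hx := abs_sub_le (xCoord a) (xCoord c) (xCoord b)
  have hy := abs_sub_le (yCoord a) (yCoord c) (yCoord b)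
  rcases not_and_or.mp h with h | h
  · linarith [abs_sub_lt_of_notMem_uIcc h]
  · linarith [abs_sub_lt_of_notMem_uIcc h]

/-- The variation on an interval is at least the length of a polygonal line with one
intermediate vertex. -/
theorem edist_add_edist_le_eVariationOn_Icc {α E : Type*} [LinearOrder α]
    [PseudoEMetricSpace E] (f : α → E) {u v t : α} (ht : t ∈ Set.Icc u v) :
    edist (f u) (f t) + edist (f t) (f v) ≤ eVariationOn f (Set.Icc u v) := by
  rw [← Set.Icc_union_Icc_eq_Icc ht.1 ht.2,
    eVariationOn.union f (isGreatest_Icc ht.1) (isLeast_Icc ht.2)]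
  exact add_le_add
    (eVariationOn.edist_le f (Set.left_mem_Icc.2 ht.1) (Set.right_mem_Icc.2 ht.1))
    (eVariationOn.edist_le f (Set.left_mem_Icc.2 ht.2) (Set.right_mem_Icc.2 ht.2))

/-- A path from `a` to `b` passing through a point `c` outside `Box(a,b)` has L1 length at
least `‖a - c‖₁ + ‖c - b‖₁`, hence strictly greater than `‖a - b‖₁`. -/
theorem length_gt_of_detour (a b c : Plane) (γ : ℝ → Plane)
    (hcont : ContinuousOn γ (Set.Icc 0 1)) (h0 : γ 0 = a) (h1 : γ 1 = b)
    (t : ℝ) (ht : t ∈ Set.Icc (0 : ℝ) 1) (hc : γ t = c) (hbox : c ∉ Box a b) :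
    ENNReal.ofReal (‖a - c‖ + ‖c - b‖) ≤ eVariationOn γ (Set.Icc 0 1) ∧
    ENNReal.ofReal ‖a - b‖ < eVariationOn γ (Set.Icc 0 1) := by
  have hlen : ENNReal.ofReal (‖a - c‖ + ‖c - b‖) ≤ eVariationOn γ (Set.Icc 0 1) := by
    have h := edist_add_edist_le_eVariationOn_Icc γ ht
    rwa [h0, h1, hc, edist_dist, edist_dist, dist_eq_norm, dist_eq_norm,
      ← ENNReal.ofReal_add (norm_nonneg _) (norm_nonneg _)] at h
  have hlt := norm_sub_lt_of_notMem_box hbox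
  refine ⟨hlen, lt_of_lt_of_le ?_ hlen⟩
  exact (ENNReal.ofReal_lt_ofReal_iff ((norm_nonneg _).trans_lt hlt)).2 hlt
end

section
/- Let S ⊆ ℝ² and p, t ∈ S. Suppose S contains an xy-monotone path from p to t. Then every shortest path from p to t in S has image contained in Box(p,t). (Paper, Lemma 2(5): 'since there is an xy-monotone path from t to p, any shortest path from p to t must be in the rectangle R(p,t)'.) -/
open scoped ENNReal

/-- A path from `p` to `q` in a set `S`: a continuous map on `[0,1]` with the prescribed
endpoints whose image on `[0,1]` lies in `S`. -/
def IsPathIn (S : Set Plane) (p q : Plane) (γ : ℝ → Plane) : Prop :=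
  ContinuousOn γ (Set.Icc 0 1) ∧ γ 0 = p ∧ γ 1 = q ∧ γ '' Set.Icc 0 1 ⊆ S

/-- The L1 length of a path: its total variation on `[0,1]` w.r.t. the L1 metric. -/
noncomputable def pathLength (γ : ℝ → Plane) : ℝ≥0∞ := eVariationOn γ (Set.Icc 0 1)

/-- Geodesic L1 distance inside `S`: the infimum of the L1 lengths of paths in `S`. -/
noncomputable def geoDist (S : Set Plane) (p q : Plane) : ℝ≥0∞ :=
  ⨅ (γ : ℝ → Plane) (_ : IsPathIn S p q γ), pathLength γ

/-- A map `γ : [0,1] → ℝ²` is xy-monotone if each of its two coordinate functions is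
monotone (nondecreasing or nonincreasing) on `[0,1]`. -/
def XYMonotone (γ : ℝ → Plane) : Prop :=
  (MonotoneOn (fun t => xCoord (γ t)) (Set.Icc 0 1) ∨
    AntitoneOn (fun t => xCoord (γ t)) (Set.Icc 0 1)) ∧
  (MonotoneOn (fun t => yCoord (γ t)) (Set.Icc 0 1) ∨
    AntitoneOn (fun t => yCoord (γ t)) (Set.Icc 0 1))

theorem dist_eq_coord_add (a b : Plane) :
    dist a b = |xCoord a - xCoord b| + |yCoord a - yCoord b| := by
  rw [WithLp.prod_dist_eq_of_L1, Real.dist_eq, Real.dist_eq]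
  rfl

/-- If a map is additive for the distance along increasing triples of times, its total variation
is at most the distance between its endpoints. -/
theorem eVariationOn_Icc_le_edist_of_dist_add_dist {E : Type*} [PseudoMetricSpace E]
    {γ : ℝ → E} {a b : ℝ} (hab : a ≤ b)
    (h : ∀ r ∈ Set.Icc a b, ∀ s ∈ Set.Icc a b, ∀ t ∈ Set.Icc a b, r ≤ s → s ≤ t →
      dist (γ r) (γ s) + dist (γ s) (γ t) = dist (γ r) (γ t)) :
    eVariationOn γ (Set.Icc a b) ≤ edist (γ a) (γ b) := by
  have he : ∀ r ∈ Set.Icc a b, ∀ s ∈ Set.Icc a b, ∀ t ∈ Set.Icc a b, r ≤ s → s ≤ t →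
      edist (γ r) (γ s) + edist (γ s) (γ t) = edist (γ r) (γ t) := by
    intro r hr s hs t ht hrs hst
    rw [edist_dist, edist_dist, edist_dist, ← ENNReal.ofReal_add dist_nonneg dist_nonneg,
      h r hr s hs t ht hrs hst]
  refine iSup_le ?_
  rintro ⟨n, u, hu, us⟩
  have hsum : ∀ k : ℕ, ∑ i ∈ Finset.range k, edist (γ (u (i + 1))) (γ (u i)) =
      edist (γ (u 0)) (γ (u k)) := by
    intro k
    induction k with
    | zero => simp
    | succ k ih =>
      rw [Finset.sum_range_succ, ih, edist_comm (γ (u (k + 1))),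
        he _ (us 0) _ (us k) _ (us (k + 1)) (hu (Nat.zero_le k)) (hu (Nat.le_succ k))]
  have ha : a ∈ Set.Icc a b := ⟨le_rfl, hab⟩
  have hb : b ∈ Set.Icc a b := ⟨hab, le_rfl⟩
  calc ∑ i ∈ Finset.range n, edist (γ (u (i + 1))) (γ (u i))
      = edist (γ (u 0)) (γ (u n)) := hsum n
    _ ≤ edist (γ a) (γ (u n)) := by
        rw [← he a ha _ (us 0) _ (us n) (us 0).1 (hu (Nat.zero_le n))]
        exact le_add_self
    _ ≤ edist (γ a) (γ b) := by
        rw [← he a ha _ (us n) b hb (us n).1 (us n).2]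
        exact le_self_add

theorem abs_sub_add_abs_sub_of_monotoneOn_or_antitoneOn {f : ℝ → ℝ} {A : Set ℝ}
    (hf : MonotoneOn f A ∨ AntitoneOn f A) {r s t : ℝ} (hr : r ∈ A) (hs : s ∈ A) (ht : t ∈ A)
    (hrs : r ≤ s) (hst : s ≤ t) : |f r - f s| + |f s - f t| = |f r - f t| := by
  rcases hf with hf | hf
  · have h₁ := hf hr hs hrs
    have h₂ := hf hs ht hst
    rw [abs_of_nonpos (by linarith), abs_of_nonpos (by linarith), abs_of_nonpos (by linarith)]
    ring
  · have h₁ := hf hr hs hrs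
    have h₂ := hf hs ht hst
    rw [abs_of_nonneg (by linarith), abs_of_nonneg (by linarith), abs_of_nonneg (by linarith)]
    ring

theorem XYMonotone.pathLength_le {γ : ℝ → Plane} (hγ : XYMonotone γ) :
    pathLength γ ≤ edist (γ 0) (γ 1) := by
  refine eVariationOn_Icc_le_edist_of_dist_add_dist zero_le_one ?_
  intro r hr s hs t ht hrs hst
  have hx := abs_sub_add_abs_sub_of_monotoneOn_or_antitoneOn hγ.1 hr hs ht hrs hst
  have hy := abs_sub_add_abs_sub_of_monotoneOn_or_antitoneOn hγ.2 hr hs ht hrs hst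
  simp only [dist_eq_coord_add] at hx hy ⊢
  linarith

theorem edist_add_edist_le_eVariationOn_Icc_s9 {E : Type*} [PseudoEMetricSpace E] (γ : ℝ → E)
    {a b s : ℝ} (hs : s ∈ Set.Icc a b) :
    edist (γ a) (γ s) + edist (γ s) (γ b) ≤ eVariationOn γ (Set.Icc a b) := by
  obtain ⟨has, hsb⟩ := hs
  calc edist (γ a) (γ s) + edist (γ s) (γ b)
      ≤ eVariationOn γ (Set.Icc a s) + eVariationOn γ (Set.Icc s b) :=
        add_le_add (eVariationOn.edist_le γ ⟨le_rfl, has⟩ ⟨has, le_rfl⟩)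
          (eVariationOn.edist_le γ ⟨le_rfl, hsb⟩ ⟨hsb, le_rfl⟩)
    _ ≤ eVariationOn γ (Set.Icc a s ∪ Set.Icc s b) :=
        eVariationOn.add_le_union γ fun _ hx _ hy => hx.2.trans hy.1
    _ = eVariationOn γ (Set.Icc a b) := by rw [Set.Icc_union_Icc_eq_Icc has hsb]

theorem mem_uIcc_of_abs_sub_add_abs_sub_le {a b c : ℝ} (h : |a - c| + |c - b| ≤ |a - b|) :
    c ∈ Set.uIcc a b := by
  rw [Set.mem_uIcc]
  grind

theorem mem_box_of_dist_add_dist_le {a b c : Plane} (h : dist a c + dist c b ≤ dist a b) :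
    c ∈ Box a b := by
  simp only [dist_eq_coord_add] at h
  have hx := abs_sub_le (xCoord a) (xCoord c) (xCoord b)
  have hy := abs_sub_le (yCoord a) (yCoord c) (yCoord b)
  exact ⟨mem_uIcc_of_abs_sub_add_abs_sub_le (by linarith),
    mem_uIcc_of_abs_sub_add_abs_sub_le (by linarith)⟩

/-- If `S` contains an xy-monotone path from `p` to `t`, then every shortest path from
`p` to `t` in `S` has image contained in `Box(p,t)`. -/
theorem shortest_path_subset_box (S : Set Plane) (p t : Plane)
    (hp : p ∈ S) (ht : t ∈ S)
    (hmono : ∃ γ, IsPathIn S p t γ ∧ XYMonotone γ) :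
    ∀ γ, IsPathIn S p t γ → pathLength γ = geoDist S p t →
      γ '' Set.Icc 0 1 ⊆ Box p t := by
  obtain ⟨η, hη, hηm⟩ := hmono
  rintro γ ⟨-, hγ0, hγ1, -⟩ hγ _ ⟨s, hs, rfl⟩
  have hle : pathLength γ ≤ edist p t := by
    rw [hγ]
    refine (iInf₂_le η hη).trans ?_
    simpa only [hη.2.1, hη.2.2.1] using hηm.pathLength_le
  have h := (edist_add_edist_le_eVariationOn_Icc_s9 γ hs).trans hle
  rw [hγ0, hγ1, edist_dist, edist_dist, edist_dist,
    ← ENNReal.ofReal_add dist_nonneg dist_nonneg, ENNReal.ofReal_le_ofReal_iff dist_nonneg] at h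
  exact mem_box_of_dist_add_dist_le h
end
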